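/- If X is a nearest neighbor Z SFT with alphabet A having more than one measure of maximal entropy, then |A| ≥ 2e^{h(X)}, i.e., log|A| - h(X) ≥ log 2. -/

import Mathlib

open MeasureTheory

abbrev Site (d : ℕ) := Fin d → ℤ

def unitVec (d : ℕ) (i : Fin d) : Site d := fun j => if j = i then 1 else 0

def adjSites {d : ℕ} (u v : Site d) : Prop :=
  ∃ i : Fin d, v = u + unitVec d i ∨ u = v + unitVec d i

def innerBd {d : ℕ} (S : Set (Site d)) : Set (Site d) :=
  {v | v ∈ S ∧ ∃ u, u ∉ S ∧ adjSites v u}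

def outerBd {d : ℕ} (S : Set (Site d)) : Set (Site d) :=
  {v | v ∉ S ∧ ∃ u, u ∈ S ∧ adjSites v u}

def cube (d n : ℕ) : Set (Site d) := {v | ∀ i, 1 ≤ v i ∧ v i ≤ (n : ℤ)}

def symBox (d n : ℕ) : Set (Site d) := {v | ∀ i, |v i| ≤ (n : ℤ)}

def symBoxR (d : ℕ) (r : ℝ) : Set (Site d) := {v | ∀ i, |((v i : ℤ) : ℝ)| ≤ r}

/-- A nearest neighbor `ℤ^d` SFT is specified by its allowed adjacent pairs
in each of the `d` cardinal directions: `adj i a b` means the pair `a b` may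
appear at sites `v, v + e i`. -/
structure NNSFT (d : ℕ) (A : Type) where
  adj : Fin d → A → A → Prop

namespace NNSFT

variable {d : ℕ} {A : Type}

/-- The points of the subshift. -/
def pts (X : NNSFT d A) : Set (Site d → A) :=
  {x | ∀ (i : Fin d) (v : Site d), X.adj i (x v) (x (v + unitVec d i))}

/-- A configuration on shape `S` is locally admissible if it contains no
forbidden adjacent pair inside `S`. -/
def locAdm (X : NNSFT d A) (S : Set (Site d)) (w : Site d → A) : Prop :=
  ∀ (i : Fin d) (v : Site d), v ∈ S → v + unitVec d i ∈ S →
    X.adj i (w v) (w (v + unitVec d i))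

/-- A configuration on shape `S` is globally admissible if it extends to a
point of the subshift. -/
def globAdm (X : NNSFT d A) (S : Set (Site d)) (w : Site d → A) : Prop :=
  ∃ x ∈ X.pts, ∀ v ∈ S, x v = w v

/-- `X` is `ε`-full with good-letter set `G`. -/
def epsFullWith [Fintype A] (X : NNSFT d A) (ε : ℝ) (G : Set A) : Prop :=
  ((G.ncard : ℝ) > (1 - ε) * Fintype.card A) ∧
  ∀ g ∈ G, ∀ i : Fin d,
    (({a : A | X.adj i g a}.ncard : ℝ) > (1 - ε) * Fintype.card A) ∧
    (({a : A | X.adj i a g}.ncard : ℝ) > (1 - ε) * Fintype.card A)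

/-- `X` is `ε`-full. -/
def epsFull [Fintype A] (X : NNSFT d A) (ε : ℝ) : Prop :=
  ∃ G : Set A, X.epsFullWith ε G

/-- The globally admissible patterns on shape `S`. -/
def langSet (X : NNSFT d A) (S : Set (Site d)) : Set (S → A) :=
  (fun x => S.restrict x) '' X.pts

/-- The number of globally admissible patterns on shape `S`. -/
noncomputable def langCard (X : NNSFT d A) (S : Set (Site d)) : ℕ :=
  (X.langSet S).ncard

/-- Topological entropy, as the infimum (= limit, by subadditivity) of the
normalized log-counts of globally admissible patterns on cubes. -/
noncomputable def entropy (X : NNSFT d A) : ℝ :=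
  ⨅ n : ℕ+, Real.log (X.langCard (cube d (n : ℕ))) / ((n : ℕ) : ℝ) ^ d

end NNSFT

instance confMS (d : ℕ) (A : Type) : MeasurableSpace (Site d → A) :=
  @MeasurableSpace.pi (Site d) (fun _ => A) (fun _ => ⊤)

def shiftMap {d : ℕ} {A : Type} (t : Site d) (x : Site d → A) : Site d → A :=
  fun v => x (v + t)

/-- Shift invariance of a measure on the full shift. -/
def shiftInv {d : ℕ} {A : Type} (μ : Measure (Site d → A)) : Prop :=
  ∀ t : Site d, Measure.map (shiftMap t) μ = μ

/-- The cylinder set of configurations agreeing with `w` on `S`. -/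
def cylEvent {d : ℕ} {A : Type} (S : Set (Site d)) (w : Site d → A) :
    Set (Site d → A) := {x | ∀ v ∈ S, x v = w v}

/-- Shannon entropy of the marginal of `μ` on the cube `[1,n]^d`. -/
noncomputable def blockEnt {d : ℕ} {A : Type} [Fintype A]
    (μ : Measure (Site d → A)) (n : ℕ) : ℝ :=
  ∑ w : (Fin d → Fin n) → A,
    Real.negMulLog
      ((μ {x | ∀ p : Fin d → Fin n, x (fun i => (p i : ℤ) + 1) = w p}).toReal)

/-- Measure-theoretic entropy, as the infimum (= limit, by subadditivity) of
normalized Shannon entropies of cube marginals. -/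
noncomputable def measEnt {d : ℕ} {A : Type} [Fintype A]
    (μ : Measure (Site d → A)) : ℝ :=
  ⨅ n : ℕ+, blockEnt μ (n : ℕ) / ((n : ℕ) : ℝ) ^ d

/-- `μ` is a measure of maximal entropy for `X`. -/
def NNSFT.isMME {d : ℕ} {A : Type} [Fintype A] (X : NNSFT d A)
    (μ : Measure (Site d → A)) : Prop :=
  IsProbabilityMeasure μ ∧ shiftInv μ ∧ μ X.pts = 1 ∧ measEnt μ = X.entropy

/-- `badConn bad S T x` : in the configuration `x` there is a path of
`bad`-letters from `S` to `T`. -/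
def badConn {d : ℕ} {A : Type} (bad : A → Prop) (S T : Set (Site d))
    (x : Site d → A) : Prop :=
  ∃ (L : ℕ) (p : ℕ → Site d), p 0 ∈ S ∧ p L ∈ T ∧
    (∀ j < L, adjSites (p j) (p (j + 1))) ∧ ∀ j ≤ L, bad (x (p j))

section Gibbs

lemma mul_log_sub_log_ge {x y : ℝ} (hx : 0 ≤ x) (hy : 0 ≤ y) (h : y = 0 → x = 0) :
    x - y ≤ x * (Real.log x - Real.log y) := by
  rcases hx.eq_or_lt with rfl | hx
  · simpa using hy
  have hy' : 0 < y := hy.lt_of_ne fun h0 => hx.ne' (h h0.symm)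
  have := Real.one_sub_inv_le_log_of_pos (div_pos hx hy')
  rw [Real.log_div hx.ne' hy'.ne'] at this
  have h2 := mul_le_mul_of_nonneg_left this hx.le
  have : x * (1 - (x / y)⁻¹) = x - y := by field_simp
  linarith

lemma eq_of_mul_log_sub_log_le {x y : ℝ} (hx : 0 ≤ x) (hy : 0 ≤ y) (h : y = 0 → x = 0)
    (heq : x * (Real.log x - Real.log y) ≤ x - y) : x = y := by
  rcases hx.eq_or_lt with rfl | hx
  · simp only [zero_mul, zero_sub] at heq
    linarith
  have hy' : 0 < y := hy.lt_of_ne fun h0 => hx.ne' (h h0.symm)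
  by_contra hne
  have hne' : y / x ≠ 1 := by
    rw [Ne, div_eq_one_iff_eq hx.ne']
    exact fun h => hne h.symm
  have := Real.log_lt_sub_one_of_pos (div_pos hy' hx) hne'
  rw [Real.log_div hy'.ne' hx.ne'] at this
  have h2 := mul_lt_mul_of_pos_left this hx
  have : x * (y / x - 1) = y - x := by field_simp
  linarith

variable {ι : Type*} [Fintype ι]

/-- Gibbs' inequality for finite nonnegative weights. -/
lemma gibbs_le {p q : ι → ℝ} (hp : ∀ i, 0 ≤ p i) (hq : ∀ i, 0 ≤ q i)
    (h : ∀ i, q i = 0 → p i = 0) (hs : ∑ i, q i ≤ ∑ i, p i) :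
    ∑ i, p i * Real.log (q i) ≤ ∑ i, p i * Real.log (p i) := by
  have h1 : ∑ i, (p i - q i) ≤ ∑ i, p i * (Real.log (p i) - Real.log (q i)) :=
    Finset.sum_le_sum fun i _ => mul_log_sub_log_ge (hp i) (hq i) (h i)
  simp only [mul_sub, Finset.sum_sub_distrib] at h1
  linarith

lemma gibbs_eq {p q : ι → ℝ} (hp : ∀ i, 0 ≤ p i) (hq : ∀ i, 0 ≤ q i)
    (h : ∀ i, q i = 0 → p i = 0) (hs : ∑ i, q i ≤ ∑ i, p i)
    (heq : ∑ i, p i * Real.log (p i) ≤ ∑ i, p i * Real.log (q i)) (i : ι) : p i = q i := by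
  have h0 : ∀ i ∈ Finset.univ,
      0 ≤ p i * (Real.log (p i) - Real.log (q i)) - (p i - q i) := fun i _ =>
    sub_nonneg.2 (mul_log_sub_log_ge (hp i) (hq i) (h i))
  have h1 : ∑ i, (p i * (Real.log (p i) - Real.log (q i)) - (p i - q i)) ≤ 0 := by
    simp only [mul_sub, Finset.sum_sub_distrib]
    linarith
  have h2 := (Finset.sum_eq_zero_iff_of_nonneg h0).1 (le_antisymm h1 (Finset.sum_nonneg h0)) i
    (Finset.mem_univ i)
  exact eq_of_mul_log_sub_log_le (hp i) (hq i) (h i) (by linarith)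

end Gibbs

section CondEnt

variable {A : Type*} [Fintype A]

/-- Conditional entropy of the second letter given the first, for weights `p` on pairs. -/
noncomputable def condEnt (p : A → A → ℝ) : ℝ :=
  ∑ a, ∑ b, p a b * (Real.log (∑ c, p a c) - Real.log (p a b))

lemma eq_zero_of_row_sum_eq_zero {p : A → A → ℝ} (hp : ∀ a b, 0 ≤ p a b) {a : A}
    (h : ∑ c, p a c = 0) (b : A) : p a b = 0 :=
  (Finset.sum_eq_zero_iff_of_nonneg fun c _ => hp a c).1 h b (Finset.mem_univ b)

variable {p k : A → A → ℝ}

lemma sum_mul_log_kernel (hp : ∀ a b, 0 ≤ p a b) (hpk : ∀ a b, p a b ≠ 0 → k a b ≠ 0) :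
    ∑ i : A × A, p i.1 i.2 * Real.log ((∑ c, p i.1 c) * k i.1 i.2) =
      (∑ i : A × A, p i.1 i.2 * Real.log (p i.1 i.2)) + condEnt p
        + ∑ a, ∑ b, p a b * Real.log (k a b) := by
  rw [Fintype.sum_prod_type, Fintype.sum_prod_type, condEnt, ← Finset.sum_add_distrib,
    ← Finset.sum_add_distrib]
  refine Finset.sum_congr rfl fun a _ => ?_
  rw [← Finset.sum_add_distrib, ← Finset.sum_add_distrib]
  refine Finset.sum_congr rfl fun b _ => ?_
  by_cases h : p a b = 0
  · simp [h]
  · rw [Real.log_mul (fun h0 => h (eq_zero_of_row_sum_eq_zero hp h0 b)) (hpk a b h)]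
    ring

lemma sum_row_mul_kernel_le (hp : ∀ a b, 0 ≤ p a b) (hk1 : ∀ a, ∑ b, k a b ≤ 1) :
    ∑ i : A × A, (∑ c, p i.1 c) * k i.1 i.2 ≤ ∑ i : A × A, p i.1 i.2 := by
  rw [Fintype.sum_prod_type, Fintype.sum_prod_type]
  refine Finset.sum_le_sum fun a _ => ?_
  dsimp only
  rw [← Finset.mul_sum]
  exact mul_le_of_le_one_right (Finset.sum_nonneg fun c _ => hp a c) (hk1 a)

lemma condEnt_le (hp : ∀ a b, 0 ≤ p a b) (hk : ∀ a b, 0 ≤ k a b)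
    (hk1 : ∀ a, ∑ b, k a b ≤ 1) (hpk : ∀ a b, p a b ≠ 0 → k a b ≠ 0) :
    condEnt p ≤ -∑ a, ∑ b, p a b * Real.log (k a b) := by
  have h := gibbs_le (p := fun i : A × A => p i.1 i.2)
    (q := fun i => (∑ c, p i.1 c) * k i.1 i.2) (fun i => hp _ _)
    (fun i => mul_nonneg (Finset.sum_nonneg fun c _ => hp _ c) (hk _ _))
    (fun i hi => by
      by_contra h
      rcases mul_eq_zero.1 hi with h0 | h0
      · exact h (eq_zero_of_row_sum_eq_zero hp h0 _)
      · exact hpk _ _ h h0)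
    (sum_row_mul_kernel_le hp hk1)
  rw [sum_mul_log_kernel hp hpk] at h
  linarith

lemma eq_of_le_condEnt (hp : ∀ a b, 0 ≤ p a b) (hk : ∀ a b, 0 ≤ k a b)
    (hk1 : ∀ a, ∑ b, k a b ≤ 1) (hpk : ∀ a b, p a b ≠ 0 → k a b ≠ 0)
    (heq : -∑ a, ∑ b, p a b * Real.log (k a b) ≤ condEnt p) (a b : A) :
    p a b = (∑ c, p a c) * k a b := by
  refine gibbs_eq (p := fun i : A × A => p i.1 i.2)
    (q := fun i => (∑ c, p i.1 c) * k i.1 i.2) (fun i => hp _ _)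
    (fun i => mul_nonneg (Finset.sum_nonneg fun c _ => hp _ c) (hk _ _))
    (fun i hi => by
      by_contra h
      rcases mul_eq_zero.1 hi with h0 | h0
      · exact h (eq_zero_of_row_sum_eq_zero hp h0 _)
      · exact hpk _ _ h h0)
    (sum_row_mul_kernel_le hp hk1) ?_ (a, b)
  rw [sum_mul_log_kernel hp hpk]
  linarith

/-- If `p` has the form of a row weight times a stochastic kernel, then its conditional entropy is
linear in the row weights. -/
lemma condEnt_mul_kernel {u : A → ℝ} (hk1 : ∀ a, u a ≠ 0 → ∑ b, k a b = 1) :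
    condEnt (fun a b => u a * k a b) = -∑ a, u a * ∑ b, k a b * Real.log (k a b) := by
  rw [condEnt, ← Finset.sum_neg_distrib]
  refine Finset.sum_congr rfl fun a _ => ?_
  by_cases ha : u a = 0
  · simp [ha]
  rw [← Finset.mul_sum, hk1 a ha, mul_one, Finset.mul_sum, ← Finset.sum_neg_distrib]
  refine Finset.sum_congr rfl fun b _ => ?_
  by_cases hb : k a b = 0
  · simp [hb]
  rw [Real.log_mul ha hb]
  ring

/-- Conditional entropy is at most the logarithm of the number of letters in use. -/
lemma condEnt_le_log_ncard (hp : ∀ a b, 0 ≤ p a b) (S : Finset A)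
    (hS : ∀ a b, p a b ≠ 0 → b ∈ S) :
    condEnt p ≤ (∑ a, ∑ b, p a b) * Real.log S.card := by
  classical
  have h := condEnt_le (k := fun _ b => if b ∈ S then (S.card : ℝ)⁻¹ else 0) hp
    (fun a b => by positivity)
    (fun a => by
      simp only [Finset.sum_ite_mem, Finset.univ_inter, Finset.sum_const, nsmul_eq_mul]
      exact mul_inv_le_one)
    (fun a b hab => by
      have hb := hS a b hab
      have : S.card ≠ 0 := Finset.card_ne_zero_of_mem hb
      simp [hb, this])
  refine h.trans_eq ?_
  rw [Finset.sum_mul, ← Finset.sum_neg_distrib]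
  refine Finset.sum_congr rfl fun a _ => ?_
  rw [Finset.sum_mul, ← Finset.sum_neg_distrib]
  refine Finset.sum_congr rfl fun b _ => ?_
  by_cases hab : p a b = 0
  · simp [hab]
  · simp [hS a b hab]

end CondEnt

section Paths

variable {A : Type*}

/-- A finite path whose letters have successors and predecessors extends to a bi-infinite path. -/
lemma exists_biinfinite_path {E : A → A → Prop} (hE : ∀ a, (∃ b, E a b) ↔ ∃ b, E b a) {n : ℕ}
    (w : Fin (n + 1) → A) (hw : ∀ i : Fin n, E (w i.castSucc) (w i.succ)) (h0 : ∃ b, E (w 0) b) :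
    ∃ x : ℤ → A, (∀ k, E (x k) (x (k + 1))) ∧ ∀ i : Fin (n + 1), x i = w i := by
  have hlast : ∃ b, E (w (Fin.last n)) b := by
    cases n with
    | zero => exact h0
    | succ n => exact (hE _).2 ⟨_, hw (Fin.last n)⟩
  have hs : ∀ a, ∃ b, (∃ c, E a c) → E a b := fun a => by
    by_cases h : ∃ c, E a c
    · exact h.imp fun c hc _ => hc
    · exact ⟨a, fun h' => (h h').elim⟩
  have ht : ∀ a, ∃ b, (∃ c, E a c) → E b a := fun a => by
    by_cases h : ∃ c, E a c
    · exact ((hE a).1 h).imp fun c hc _ => hc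
    · exact ⟨a, fun h' => (h h').elim⟩
  choose s hs using hs
  choose t ht using ht
  have hsn : ∀ m, ∃ c, E (s^[m] (w (Fin.last n))) c := fun m => by
    induction m with
    | zero => exact hlast
    | succ m ih =>
      rw [Function.iterate_succ_apply']
      exact (hE _).2 ⟨_, hs _ ih⟩
  have htn : ∀ m, ∃ c, E (t^[m] (w 0)) c := fun m => by
    induction m with
    | zero => exact h0
    | succ m ih =>
      rw [Function.iterate_succ_apply']
      exact ⟨_, ht _ ih⟩
  let f : ℕ → A := fun k => if h : k < n + 1 then w ⟨k, h⟩ else s^[k - n] (w (Fin.last n))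
  have hfw : ∀ i : Fin (n + 1), f i = w i := fun i => by simp only [f, i.2, dite_true]
  have hf0 : f 0 = w 0 := hfw 0
  have hfn : ∀ k, n ≤ k → f k = s^[k - n] (w (Fin.last n)) := fun k hk => by
    rcases hk.eq_or_lt with rfl | hk
    · simp [f, Fin.last]
    · simp only [f, show ¬k < n + 1 by omega, dite_false]
  have hf : ∀ k, E (f k) (f (k + 1)) := fun k => by
    rcases lt_or_ge k n with hk | hk
    · have := hw ⟨k, hk⟩
      rw [← hfw, ← hfw] at this
      exact this
    · rw [hfn k hk, hfn (k + 1) (by omega), show k + 1 - n = k - n + 1 by omega,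
        Function.iterate_succ_apply']
      exact hs _ (hsn _)
  let x : ℤ → A := fun k => Int.casesOn k f fun m => t^[m + 1] (w 0)
  refine ⟨x, fun k => ?_, fun i => ?_⟩
  · match k with
    | Int.ofNat k => exact hf k
    | Int.negSucc 0 =>
      change E (t (w 0)) (f 0)
      rw [hf0]
      exact ht _ h0
    | Int.negSucc (m + 1) =>
      change E (t^[m + 2] (w 0)) (t^[m + 1] (w 0))
      rw [Function.iterate_succ_apply' _ (m + 1)]
      exact ht _ (htn _)
  · exact hfw i

variable [Fintype A]

open scoped Classical in
/-- Paths with `n` steps starting at `a`. -/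
noncomputable def pathsFrom (E : A → A → Prop) (n : ℕ) (a : A) : Finset (Fin (n + 1) → A) :=
  {w | w 0 = a ∧ ∀ i : Fin n, E (w i.castSucc) (w i.succ)}

lemma mem_pathsFrom {E : A → A → Prop} {n : ℕ} {a : A} {w : Fin (n + 1) → A} :
    w ∈ pathsFrom E n a ↔ w 0 = a ∧ ∀ i : Fin n, E (w i.castSucc) (w i.succ) := by
  simp [pathsFrom]

lemma cons_mem_pathsFrom {E : A → A → Prop} {n : ℕ} {a b : A} {w : Fin (n + 1) → A}
    (hab : E a b) (hw : w ∈ pathsFrom E n b) :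
    (Fin.cons a w : Fin (n + 2) → A) ∈ pathsFrom E (n + 1) a := by
  rw [mem_pathsFrom] at hw ⊢
  refine ⟨rfl, fun i => ?_⟩
  refine Fin.cases ?_ (fun j => ?_) i
  · simpa [hw.1] using hab
  · simpa using hw.2 j

lemma pathsFrom_nonempty {E : A → A → Prop} (hE : ∀ a, (∃ b, E a b) ↔ ∃ b, E b a) (n : ℕ)
    {a : A} (ha : ∃ b, E a b) : (pathsFrom E n a).Nonempty := by
  induction n generalizing a with
  | zero => exact ⟨fun _ => a, mem_pathsFrom.2 ⟨rfl, fun i => i.elim0⟩⟩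
  | succ n ih =>
    obtain ⟨b, hb⟩ := ha
    obtain ⟨w, hw⟩ := ih ((hE b).2 ⟨a, hb⟩)
    exact ⟨_, cons_mem_pathsFrom hb hw⟩

open scoped Classical in
lemma sum_card_pathsFrom_le (E : A → A → Prop) (n : ℕ) (a : A) :
    ∑ b with E a b, (pathsFrom E n b).card ≤ (pathsFrom E (n + 1) a).card := by
  have hinj : Function.Injective fun w : Fin (n + 1) → A => (Fin.cons a w : Fin (n + 2) → A) :=
    Fin.cons_right_injective (α := fun _ => A) a
  have := Finset.card_biUnion (s := {b | E a b})
    (t := fun b => (pathsFrom E n b).image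
      fun w : Fin (n + 1) → A => (Fin.cons a w : Fin (n + 2) → A)) (by
    intro b _ c _ hbc
    rw [Function.onFun, Finset.disjoint_image hinj, Finset.disjoint_left]
    intro w hb hc
    exact hbc ((mem_pathsFrom.1 hb).1.symm.trans (mem_pathsFrom.1 hc).1))
  simp only [Finset.card_image_of_injective _ hinj] at this
  rw [← this]
  refine Finset.card_le_card fun w hw => ?_
  simp only [Finset.mem_biUnion, Finset.mem_image, Finset.mem_filter] at hw
  obtain ⟨b, ⟨_, hb⟩, w, hw, rfl⟩ := hw
  exact cons_mem_pathsFrom hb hw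

variable {p : A → A → ℝ}

/-- The conditional entropy of a stationary weight on pairs is bounded by the growth of the
number of paths in its support. -/
lemma mul_condEnt_le_sum_log_card (hp : ∀ a b, 0 ≤ p a b)
    (hst : ∀ a, ∑ b, p a b = ∑ b, p b a) (hE : ∀ a, (∃ b, p a b ≠ 0) ↔ ∃ b, p b a ≠ 0) (n : ℕ) :
    n * condEnt p ≤ ∑ a, ∑ b, p a b * Real.log (pathsFrom (p · · ≠ 0) n b).card := by
  classical
  induction n with
  | zero =>
    simp only [Nat.cast_zero, zero_mul]
    exact Finset.sum_nonneg fun a _ => Finset.sum_nonneg fun b _ =>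
      mul_nonneg (hp a b) (Real.log_natCast_nonneg _)
  | succ n ih =>
    set r : ℕ → A → ℝ := fun m a => ((pathsFrom (p · · ≠ 0) m a).card : ℝ) with hr
    have hr0 : ∀ m a b, p a b ≠ 0 → r m a ≠ 0 ∧ r m b ≠ 0 := fun m a b hab =>
      ⟨Nat.cast_ne_zero.2 (pathsFrom_nonempty hE m ⟨b, hab⟩).card_ne_zero,
        Nat.cast_ne_zero.2 (pathsFrom_nonempty hE m ((hE b).2 ⟨a, hab⟩)).card_ne_zero⟩
    have h := condEnt_le (k := fun a b => if p a b ≠ 0 then r n b / r (n + 1) a else 0) hp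
      (fun a b => by positivity)
      (fun a => by
        rw [← Finset.sum_filter, ← Finset.sum_div]
        refine div_le_one_of_le₀ ?_ (by positivity)
        simp only [hr]
        exact_mod_cast sum_card_pathsFrom_le (p · · ≠ 0) n a)
      (fun a b hab => by
        simp only [if_pos hab]
        exact div_ne_zero (hr0 n a b hab).2 (hr0 (n + 1) a b hab).1)
    have h2 : ∑ a, ∑ b, p a b * Real.log (if p a b ≠ 0 then r n b / r (n + 1) a else 0)
        = (∑ a, ∑ b, p a b * Real.log (r n b)) - ∑ a, ∑ b, p a b * Real.log (r (n + 1) a) := by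
      rw [← Finset.sum_sub_distrib]
      refine Finset.sum_congr rfl fun a _ => ?_
      rw [← Finset.sum_sub_distrib]
      refine Finset.sum_congr rfl fun b _ => ?_
      by_cases hab : p a b = 0
      · simp [hab]
      · rw [if_pos hab, Real.log_div (hr0 n a b hab).2 (hr0 (n + 1) a b hab).1, mul_sub]
    have h3 : ∑ a, ∑ b, p a b * Real.log (r (n + 1) a)
        = ∑ a, ∑ b, p a b * Real.log (r (n + 1) b) := by
      rw [Finset.sum_comm (f := fun a b => p a b * Real.log (r (n + 1) b))]
      simp only [← Finset.sum_mul, hst]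
    rw [h2, h3] at h
    push_cast
    linarith

lemma succ_mul_condEnt_le_log_card (hp : ∀ a b, 0 ≤ p a b)
    (hst : ∀ a, ∑ b, p a b = ∑ b, p b a) (hE : ∀ a, (∃ b, p a b ≠ 0) ↔ ∃ b, p b a ≠ 0)
    (S : Finset A) (hS : ∀ a, a ∈ S ↔ ∃ b, p a b ≠ 0) (n : ℕ) :
    (n + 1) * condEnt p ≤ (∑ a, ∑ b, p a b) *
      Real.log (∑ a ∈ S, (pathsFrom (p · · ≠ 0) n a).card : ℕ) := by
  classical
  have h1 := mul_condEnt_le_sum_log_card hp hst hE n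
  set r : A → ℝ := fun a => ((pathsFrom (p · · ≠ 0) n a).card : ℝ) with hr
  set W : ℝ := ((∑ a ∈ S, (pathsFrom (p · · ≠ 0) n a).card : ℕ) : ℝ) with hW
  have hWr : W = ∑ a ∈ S, r a := Nat.cast_sum _ _
  have hbS : ∀ a b, p a b ≠ 0 → b ∈ S := fun a b hab => (hS b).2 ((hE b).2 ⟨a, hab⟩)
  have hr0 : ∀ b ∈ S, 0 < r b := fun b hb =>
    Nat.cast_pos.2 (pathsFrom_nonempty hE n ((hS b).1 hb)).card_pos
  have hW0 : ∀ b ∈ S, W ≠ 0 := fun b hb => by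
    rw [hWr]
    exact (Finset.sum_pos hr0 ⟨b, hb⟩).ne'
  have h1r : n * condEnt p ≤ ∑ a, ∑ b, p a b * Real.log (r b) := h1
  have hWnn : 0 ≤ W := Nat.cast_nonneg _
  have hrnn : ∀ b, 0 ≤ r b := fun b => Nat.cast_nonneg _
  clear_value r W
  have h := condEnt_le (k := fun _ b => if b ∈ S then r b / W else 0) hp
    (fun a b => by
      split_ifs
      exacts [div_nonneg (hrnn b) hWnn, le_rfl])
    (fun a => by
      rw [Finset.sum_ite_mem, Finset.univ_inter, ← Finset.sum_div, ← hWr]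
      exact div_self_le_one W)
    (fun a b hab => by
      rw [if_pos (hbS a b hab)]
      exact div_ne_zero (hr0 b (hbS a b hab)).ne' (hW0 b (hbS a b hab)))
  have h2 : ∑ a, ∑ b, p a b * Real.log (if b ∈ S then r b / W else 0)
      = (∑ a, ∑ b, p a b * Real.log (r b)) - (∑ a, ∑ b, p a b) * Real.log W := by
    rw [Finset.sum_mul, ← Finset.sum_sub_distrib]
    refine Finset.sum_congr rfl fun a _ => ?_
    rw [Finset.sum_mul, ← Finset.sum_sub_distrib]
    refine Finset.sum_congr rfl fun b _ => ?_
    by_cases hab : p a b = 0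
    · simp [hab]
    · have hb := hbS a b hab
      rw [if_pos hb, Real.log_div (hr0 b hb).ne' (hW0 b hb), mul_sub]
  rw [h2] at h
  linarith

end Paths

section Variational

variable {A : Type} [Fintype A]

lemma finite_cube (d n : ℕ) : (cube d n).Finite :=
  (Set.finite_Icc (fun _ => (1 : ℤ)) fun _ => (n : ℤ)).subset fun _ hv =>
    ⟨fun i => (hv i).1, fun i => (hv i).2⟩

lemma sum_card_pathsFrom_le_langCard (X : NNSFT 1 A) {E : A → A → Prop}
    (hX : ∀ a b, E a b → X.adj 0 a b) (hE : ∀ a, (∃ b, E a b) ↔ ∃ b, E b a)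
    (S : Finset A) (hS : ∀ a ∈ S, ∃ b, E a b) (n : ℕ) :
    ∑ a ∈ S, (pathsFrom E n a).card ≤ X.langCard (cube 1 (n + 1)) := by
  classical
  have hdis : (S : Set A).PairwiseDisjoint (pathsFrom E n) := by
    intro b _ c _ hbc
    rw [Function.onFun, Finset.disjoint_left]
    intro w hb hc
    exact hbc ((mem_pathsFrom.1 hb).1.symm.trans (mem_pathsFrom.1 hc).1)
  rw [← Finset.card_biUnion hdis]
  have hmem : ∀ i : Fin (n + 1), (fun _ => (i : ℤ) + 1) ∈ cube 1 (n + 1) := fun i _ => by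
    constructor <;> dsimp only <;> push_cast <;> omega
  let Φ : (cube 1 (n + 1) → A) → Fin (n + 1) → A := fun y i => y ⟨_, hmem i⟩
  have : Finite (cube 1 (n + 1)) := finite_cube 1 (n + 1)
  have hfin : (X.langSet (cube 1 (n + 1))).Finite := Set.toFinite _
  refine le_trans ?_ (Set.ncard_image_le (f := Φ) hfin)
  rw [← Set.ncard_coe_finset]
  refine Set.ncard_le_ncard (fun w hw => ?_) (hfin.image _)
  simp only [Finset.coe_biUnion, Set.mem_iUnion, Finset.mem_coe, mem_pathsFrom] at hw
  obtain ⟨a, ha, rfl, hw⟩ := hw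
  obtain ⟨x, hx, hxw⟩ := exists_biinfinite_path hE w hw (hS _ ha)
  refine ⟨_, ⟨fun v => x (v 0 - 1), fun i v => ?_, rfl⟩, ?_⟩
  · obtain rfl := Subsingleton.elim i 0
    have := hX _ _ (hx (v 0 - 1))
    simpa [unitVec, add_sub_right_comm] using this
  · funext i
    change x ((i : ℤ) + 1 - 1) = w i
    rw [add_sub_cancel_right, hxw]

/-- A stationary weight on allowed pairs has conditional entropy at most that of the SFT. -/
lemma condEnt_le_entropy (X : NNSFT 1 A) {p : A → A → ℝ} (hp : ∀ a b, 0 ≤ p a b)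
    (hst : ∀ a, ∑ b, p a b = ∑ b, p b a) (hX : ∀ a b, p a b ≠ 0 → X.adj 0 a b) :
    condEnt p ≤ (∑ a, ∑ b, p a b) * X.entropy := by
  classical
  have hE : ∀ a, (∃ b, p a b ≠ 0) ↔ ∃ b, p b a ≠ 0 := fun a => by
    rw [← not_iff_not]
    push Not
    have h1 := Finset.sum_eq_zero_iff_of_nonneg (s := Finset.univ) fun b _ => hp a b
    have h2 := Finset.sum_eq_zero_iff_of_nonneg (s := Finset.univ) fun b _ => hp b a
    simp only [Finset.mem_univ, true_implies] at h1 h2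
    rw [← h1, ← h2, hst]
  have hM : 0 ≤ ∑ a, ∑ b, p a b :=
    Finset.sum_nonneg fun a _ => Finset.sum_nonneg fun b _ => hp a b
  set M := ∑ a, ∑ b, p a b with hMdef
  rcases hM.eq_or_lt with hM0 | hM0
  · have hz : ∀ a b, p a b = 0 := fun a => eq_zero_of_row_sum_eq_zero hp
      ((Finset.sum_eq_zero_iff_of_nonneg fun a _ => Finset.sum_nonneg fun b _ => hp a b).1
        hM0.symm a (Finset.mem_univ a))
    rw [← hM0]
    simp [condEnt, hz]
  rw [← div_le_iff₀' hM0]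
  refine le_ciInf fun n => ?_
  obtain ⟨n, rfl⟩ : ∃ m : ℕ, n = m.succPNat := ⟨n.natPred, n.succPNat_natPred.symm⟩
  have h1 := succ_mul_condEnt_le_log_card hp hst hE {a | ∃ b, p a b ≠ 0} (by simp) n
  have h2 := sum_card_pathsFrom_le_langCard X hX hE {a | ∃ b, p a b ≠ 0} (by simp) n
  set W := ∑ a with ∃ b, p a b ≠ 0, (pathsFrom (p · · ≠ 0) n a).card with hW
  have hlog : Real.log (W : ℝ) ≤ Real.log (X.langCard (cube 1 (n + 1))) := by
    rcases W.eq_zero_or_pos with h0 | h0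
    · rw [h0]
      simpa using Real.log_natCast_nonneg _
    · exact Real.log_le_log (by exact_mod_cast h0) (by exact_mod_cast h2)
  simp only [Nat.succPNat_coe, Nat.succ_eq_add_one, pow_one]
  rw [div_le_div_iff₀ hM0 (by positivity)]
  push_cast
  have := mul_le_mul_of_nonneg_left hlog hM
  linarith

lemma exp_entropy_le_card (X : NNSFT 1 A) {p : A → A → ℝ} (hp : ∀ a b, 0 ≤ p a b)
    (hM : 0 < ∑ a, ∑ b, p a b) (hent : (∑ a, ∑ b, p a b) * X.entropy ≤ condEnt p)
    (S : Finset A) (hS : ∀ a b, p a b ≠ 0 → b ∈ S) :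
    Real.exp X.entropy ≤ S.card := by
  have hne : 0 < S.card := by
    by_contra h0
    have hS0 : S = ∅ := by simpa using h0
    have hz : ∀ a b, p a b = 0 := fun a b => by
      by_contra hab
      simpa [hS0] using hS a b hab
    simp [hz] at hM
  rw [← Real.le_log_iff_exp_le (by exact_mod_cast hne)]
  exact le_of_mul_le_mul_left (hent.trans (condEnt_le_log_ncard hp S hS)) hM

end Variational

section Pairs

variable {A : Type} [Fintype A]

/-- The positive part of the difference of two stationary vectors is stationary. -/
lemma sum_posPart_mul_kernel {k : A → A → ℝ} (hk : ∀ a b, 0 ≤ k a b)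
    (hk1 : ∀ a, ∑ b, k a b ≤ 1) {x y : A → ℝ} (hx : ∀ b, ∑ a, x a * k a b = x b)
    (hy : ∀ b, ∑ a, y a * k a b = y b) (b : A) :
    ∑ a, max (x a - y a) 0 * k a b = max (x b - y b) 0 := by
  have hle : ∀ b ∈ Finset.univ, max (x b - y b) 0 ≤ ∑ a, max (x a - y a) 0 * k a b := fun b _ => by
    refine max_le ?_ (Finset.sum_nonneg fun a _ => mul_nonneg (le_max_right _ _) (hk a b))
    rw [← hx b, ← hy b, ← Finset.sum_sub_distrib]
    refine Finset.sum_le_sum fun a _ => ?_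
    rw [← sub_mul]
    exact mul_le_mul_of_nonneg_right (le_max_left _ _) (hk a b)
  have hge : ∑ b, ∑ a, max (x a - y a) 0 * k a b ≤ ∑ b, max (x b - y b) 0 := by
    rw [Finset.sum_comm]
    refine Finset.sum_le_sum fun a _ => ?_
    rw [← Finset.mul_sum]
    exact mul_le_of_le_one_right (le_max_right _ _) (hk1 a)
  exact ((Finset.sum_eq_sum_iff_of_le hle).1 (le_antisymm (Finset.sum_le_sum hle) hge) b
    (Finset.mem_univ b)).symm

/-- If a stationary weight `x` for the kernel `k` has maximal entropy, then for every other
stationary weight `y` the set where `x` exceeds `y` has at least `exp h` letters. -/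
lemma exp_entropy_le_card_lt (X : NNSFT 1 A) {k : A → A → ℝ} (hk : ∀ a b, 0 ≤ k a b)
    (hk1 : ∀ a, ∑ b, k a b ≤ 1) (hX : ∀ a b, k a b ≠ 0 → X.adj 0 a b) {x y : A → ℝ}
    (hx0 : ∀ a, 0 ≤ x a) (hy0 : ∀ a, 0 ≤ y a) (hxk : ∀ a, x a ≠ 0 → ∑ b, k a b = 1)
    (hx : ∀ b, ∑ a, x a * k a b = x b) (hy : ∀ b, ∑ a, y a * k a b = y b)
    (hent : (∑ a, x a) * X.entropy ≤ condEnt fun a b => x a * k a b) (S : Finset A)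
    (hS : ∀ a, a ∈ S ↔ y a < x a) (hne : ∃ a, y a < x a) :
    Real.exp X.entropy ≤ S.card := by
  set u : A → ℝ := fun a => max (x a - y a) 0 with hu
  have hu0 : ∀ a, 0 ≤ u a := fun a => le_max_right _ _
  have hux : ∀ a, u a ≤ x a := fun a => max_le (by linarith [hy0 a]) (hx0 a)
  have hu_pos : ∀ a, u a ≠ 0 ↔ y a < x a := fun a => by
    rw [← (hu0 a).lt_iff_ne']
    simp [hu]
  have hust : ∀ b, ∑ a, u a * k a b = u b := sum_posPart_mul_kernel hk hk1 hx hy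
  have huk : ∀ a, u a ≠ 0 → ∑ b, k a b = 1 := fun a ha =>
    hxk a fun h0 => ha (le_antisymm (h0 ▸ hux a) (hu0 a))
  have hzk : ∀ a, x a - u a ≠ 0 → ∑ b, k a b = 1 := fun a ha =>
    hxk a fun h0 => ha (by
      have : u a = 0 := le_antisymm (h0 ▸ hux a) (hu0 a)
      rw [h0, this, sub_zero])
  have hrow : ∀ a, ∑ b, u a * k a b = u a := fun a => by
    rw [← Finset.mul_sum]
    by_cases ha : u a = 0
    · simp [ha]
    · rw [huk a ha, mul_one]
  have hrowz : ∀ a, ∑ b, (x a - u a) * k a b = x a - u a := fun a => by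
    rw [← Finset.mul_sum]
    by_cases ha : x a - u a = 0
    · simp [ha]
    · rw [hzk a ha, mul_one]
  have hz := condEnt_le_entropy X (p := fun a b => (x a - u a) * k a b)
    (fun a b => mul_nonneg (sub_nonneg.2 (hux a)) (hk a b))
    (fun a => by
      rw [hrowz]
      simp only [sub_mul, Finset.sum_sub_distrib, hx, hust])
    (fun a b hab => hX a b (right_ne_zero_of_mul hab))
  have hadd : (condEnt fun a b => x a * k a b) =
      (condEnt fun a b => u a * k a b) + condEnt fun a b => (x a - u a) * k a b := by
    rw [condEnt_mul_kernel hxk, condEnt_mul_kernel huk,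
      condEnt_mul_kernel (u := fun a => x a - u a) hzk]
    simp only [sub_mul, Finset.sum_sub_distrib]
    ring
  refine exp_entropy_le_card X (p := fun a b => u a * k a b)
    (fun a b => mul_nonneg (hu0 a) (hk a b)) ?_ ?_ S fun a b hab => ?_
  · simp only [hrow]
    obtain ⟨a, ha⟩ := hne
    exact Finset.sum_pos' (fun a _ => hu0 a)
      ⟨a, Finset.mem_univ a, (hu0 a).lt_of_ne' ((hu_pos a).2 ha)⟩
  · simp only [hrowz, Finset.sum_sub_distrib] at hz
    simp only [hrow]
    linarith
  · rw [hS, ← hu_pos, ← hust b]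
    intro h0
    exact hab ((Finset.sum_eq_zero_iff_of_nonneg fun a _ => mul_nonneg (hu0 a) (hk a b)).1 h0 a
      (Finset.mem_univ a))

lemma condEnt_eq_kernel {m : A → A → ℝ} (hm : ∀ a b, 0 ≤ m a b) :
    condEnt m = -∑ a, ∑ b, m a b * Real.log (m a b / ∑ c, m a c) := by
  rw [condEnt, ← Finset.sum_neg_distrib]
  refine Finset.sum_congr rfl fun a _ => ?_
  rw [← Finset.sum_neg_distrib]
  refine Finset.sum_congr rfl fun b _ => ?_
  by_cases hab : m a b = 0
  · simp [hab]
  · rw [Real.log_div hab fun h0 => hab (eq_zero_of_row_sum_eq_zero hm h0 b)]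
    ring

lemma eq_or_two_mul_exp_entropy_le (X : NNSFT 1 A) {p q : A → A → ℝ} (hp : ∀ a b, 0 ≤ p a b)
    (hq : ∀ a b, 0 ≤ q a b) (hpst : ∀ a, ∑ b, p a b = ∑ b, p b a)
    (hqst : ∀ a, ∑ b, q a b = ∑ b, q b a) (hpX : ∀ a b, p a b ≠ 0 → X.adj 0 a b)
    (hqX : ∀ a b, q a b ≠ 0 → X.adj 0 a b) (hmass : ∑ a, ∑ b, p a b = ∑ a, ∑ b, q a b)
    (hpent : (∑ a, ∑ b, p a b) * X.entropy ≤ condEnt p)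
    (hqent : (∑ a, ∑ b, q a b) * X.entropy ≤ condEnt q) :
    p = q ∨ 2 * Real.exp X.entropy ≤ Fintype.card A := by
  classical
  set m : A → A → ℝ := fun a b => p a b + q a b with hmdef
  have hm : ∀ a b, 0 ≤ m a b := fun a b => add_nonneg (hp a b) (hq a b)
  have hpm : ∀ a b, p a b ≠ 0 → m a b ≠ 0 := fun a b h =>
    (add_pos_of_pos_of_nonneg ((hp a b).lt_of_ne' h) (hq a b)).ne'
  have hqm : ∀ a b, q a b ≠ 0 → m a b ≠ 0 := fun a b h =>
    (add_pos_of_nonneg_of_pos (hp a b) ((hq a b).lt_of_ne' h)).ne'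
  have hmX : ∀ a b, m a b ≠ 0 → X.adj 0 a b := fun a b hab => by
    by_cases h : p a b = 0
    · exact hqX a b fun h' => hab (by simp [hmdef, h, h'])
    · exact hpX a b h
  have hment := condEnt_le_entropy X hm
    (fun a => by simp only [hmdef, Finset.sum_add_distrib, hpst, hqst]) hmX
  set k : A → A → ℝ := fun a b => m a b / ∑ c, m a c with hk
  have hk0 : ∀ a b, 0 ≤ k a b := fun a b =>
    div_nonneg (hm a b) (Finset.sum_nonneg fun c _ => hm a c)
  have hmk : ∀ a b, m a b ≠ 0 → k a b ≠ 0 := fun a b hab =>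
    div_ne_zero hab fun h0 => hab (eq_zero_of_row_sum_eq_zero hm h0 b)
  have hk1 : ∀ a, ∑ b, k a b ≤ 1 := fun a => by
    rw [← Finset.sum_div]
    exact div_self_le_one _
  have hk1' : ∀ a b, m a b ≠ 0 → ∑ b, k a b = 1 := fun a b hab => by
    rw [← Finset.sum_div]
    exact div_self fun h0 => hab (eq_zero_of_row_sum_eq_zero hm h0 b)
  have hkX : ∀ a b, k a b ≠ 0 → X.adj 0 a b := fun a b hab =>
    hmX a b fun h0 => hab (by simp [hk, h0])
  have h1 := condEnt_le hp hk0 hk1 fun a b h => hmk a b (hpm a b h)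
  have h2 := condEnt_le hq hk0 hk1 fun a b h => hmk a b (hqm a b h)
  have h3 : condEnt m = -(∑ a, ∑ b, p a b * Real.log (k a b))
      + -∑ a, ∑ b, q a b * Real.log (k a b) := by
    rw [condEnt_eq_kernel hm]
    simp only [← neg_add, ← Finset.sum_add_distrib, ← add_mul]
    rfl
  have h4 : ∑ a, ∑ b, m a b = ∑ a, ∑ b, p a b + ∑ a, ∑ b, q a b := by
    simp only [hmdef, Finset.sum_add_distrib]
  rw [h3, h4, add_mul] at hment
  have hpk := eq_of_le_condEnt hp hk0 hk1 (fun a b h => hmk a b (hpm a b h)) (by linarith)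
  have hqk := eq_of_le_condEnt hq hk0 hk1 (fun a b h => hmk a b (hqm a b h)) (by linarith)
  set x : A → ℝ := fun a => ∑ c, p a c with hx
  set y : A → ℝ := fun a => ∑ c, q a c with hy
  have hx0 : ∀ a, 0 ≤ x a := fun a => Finset.sum_nonneg fun c _ => hp a c
  have hy0 : ∀ a, 0 ≤ y a := fun a => Finset.sum_nonneg fun c _ => hq a c
  have hpk' : p = fun a b => x a * k a b := funext fun a => funext fun b => hpk a b
  have hqk' : q = fun a b => y a * k a b := funext fun a => funext fun b => hqk a b
  by_cases hxy : x = y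
  · exact Or.inl (by rw [hpk', hqk', hxy])
  right
  have hxk : ∀ a, x a ≠ 0 → ∑ b, k a b = 1 := fun a ha => by
    obtain ⟨b, _, hb⟩ := Finset.exists_ne_zero_of_sum_ne_zero ha
    exact hk1' a b (hpm a b hb)
  have hyk : ∀ a, y a ≠ 0 → ∑ b, k a b = 1 := fun a ha => by
    obtain ⟨b, _, hb⟩ := Finset.exists_ne_zero_of_sum_ne_zero ha
    exact hk1' a b (hqm a b hb)
  have hxst : ∀ b, ∑ a, x a * k a b = x b := fun b => by
    exact (Finset.sum_congr rfl fun a _ => (hpk a b).symm).trans (hpst b).symm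
  have hyst : ∀ b, ∑ a, y a * k a b = y b := fun b => by
    exact (Finset.sum_congr rfl fun a _ => (hqk a b).symm).trans (hqst b).symm
  have hex : ∀ {f g : A → ℝ}, f ≠ g → ∑ a, f a = ∑ a, g a → ∃ a, f a < g a := by
    intro f g hfg hs
    by_contra! hle
    exact hfg (funext fun a =>
      ((Finset.sum_eq_sum_iff_of_le fun a _ => hle a).1 hs.symm a (Finset.mem_univ a)).symm)
  have hX1 := exp_entropy_le_card_lt X hk0 hk1 hkX hx0 hy0 hxk hxst hyst (hpk' ▸ hpent)
    {a | y a < x a} (by simp) (hex (Ne.symm hxy) hmass.symm)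
  have hX2 := exp_entropy_le_card_lt X hk0 hk1 hkX hy0 hx0 hyk hyst hxst (hqk' ▸ hqent)
    {a | x a < y a} (by simp) (hex hxy hmass)
  have hcard : (Finset.card {a | y a < x a} + Finset.card {a | x a < y a} : ℕ) ≤
      Fintype.card A := by
    rw [← Finset.card_union_of_disjoint]
    · exact Finset.card_le_univ _
    · rw [Finset.disjoint_filter]
      exact fun a _ h => h.le.not_gt
  have : (Finset.card {a | y a < x a} : ℝ) + Finset.card {a | x a < y a} ≤ Fintype.card A := by
    exact_mod_cast hcard
  linarith

end Pairs

section WordEntropy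

/-- Strong subadditivity of entropy. -/
lemma negMulLog_ssa {B W C : Type*} [Fintype B] [Fintype W] [Fintype C] {F : B → W → C → ℝ}
    (hF : ∀ b w c, 0 ≤ F b w c) :
    (∑ b, ∑ w, ∑ c, (F b w c).negMulLog) + ∑ w, (∑ b, ∑ c, F b w c).negMulLog ≤
      (∑ b, ∑ w, (∑ c, F b w c).negMulLog) + ∑ w, ∑ c, (∑ b, F b w c).negMulLog ∧
    ((∑ b, ∑ w, (∑ c, F b w c).negMulLog) + ∑ w, ∑ c, (∑ b, F b w c).negMulLog ≤
      (∑ b, ∑ w, ∑ c, (F b w c).negMulLog) + ∑ w, (∑ b, ∑ c, F b w c).negMulLog →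
      ∀ b w c, F b w c = (∑ c, F b w c) * (∑ b, F b w c) / ∑ b, ∑ c, F b w c) := by
  set G₁ : B → W → ℝ := fun b w => ∑ c, F b w c with hG₁
  set G₂ : W → C → ℝ := fun w c => ∑ b, F b w c with hG₂
  set G : W → ℝ := fun w => ∑ b, ∑ c, F b w c with hG
  have hG₁0 : ∀ b w, 0 ≤ G₁ b w := fun b w => Finset.sum_nonneg fun c _ => hF b w c
  have hG₂0 : ∀ w c, 0 ≤ G₂ w c := fun w c => Finset.sum_nonneg fun b _ => hF b w c
  have hG0 : ∀ w, 0 ≤ G w := fun w => Finset.sum_nonneg fun b _ => hG₁0 b w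
  have hz₁ : ∀ b w c, G₁ b w = 0 → F b w c = 0 := fun b w c h =>
    (Finset.sum_eq_zero_iff_of_nonneg fun c _ => hF b w c).1 h c (Finset.mem_univ c)
  have hz₂ : ∀ b w c, G₂ w c = 0 → F b w c = 0 := fun b w c h =>
    (Finset.sum_eq_zero_iff_of_nonneg fun b _ => hF b w c).1 h b (Finset.mem_univ b)
  have hz : ∀ b w c, G w = 0 → F b w c = 0 := fun b w c h => hz₁ b w c
    ((Finset.sum_eq_zero_iff_of_nonneg fun b _ => hG₁0 b w).1 h b (Finset.mem_univ b))
  let p : B × W × C → ℝ := fun i => F i.1 i.2.1 i.2.2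
  let q : B × W × C → ℝ := fun i => G₁ i.1 i.2.1 * G₂ i.2.1 i.2.2 / G i.2.1
  have hp : ∀ i, 0 ≤ p i := fun i => hF _ _ _
  have hq : ∀ i, 0 ≤ q i := fun i => div_nonneg (mul_nonneg (hG₁0 _ _) (hG₂0 _ _)) (hG0 _)
  have hpq : ∀ i, q i = 0 → p i = 0 := by
    rintro ⟨b, w, c⟩ h
    rcases div_eq_zero_iff.1 h with h | h
    · rcases mul_eq_zero.1 h with h | h
      · exact hz₁ b w c h
      · exact hz₂ b w c h
    · exact hz b w c h
  have hs : ∑ i, q i ≤ ∑ i, p i := by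
    simp only [Fintype.sum_prod_type, p, q]
    rw [Finset.sum_comm, Finset.sum_comm (f := fun b w => ∑ c, F b w c)]
    refine Finset.sum_le_sum fun w _ => ?_
    have hw : ∑ c, G₂ w c = G w := Finset.sum_comm
    simp only [← Finset.sum_div, ← Finset.mul_sum, ← Finset.sum_mul, hw]
    change G w * G w / G w ≤ G w
    exact (mul_self_div_self _).le
  have hlog : ∀ b w c, F b w c * Real.log (G₁ b w * G₂ w c / G w) =
      F b w c * Real.log (G₁ b w) + F b w c * Real.log (G₂ w c) - F b w c * Real.log (G w) :=
    fun b w c => by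
    by_cases h : F b w c = 0
    · simp [h]
    have h₁ : G₁ b w ≠ 0 := fun h' => h (hz₁ b w c h')
    have h₂ : G₂ w c ≠ 0 := fun h' => h (hz₂ b w c h')
    have h₃ : G w ≠ 0 := fun h' => h (hz b w c h')
    rw [Real.log_div (mul_ne_zero h₁ h₂) h₃, Real.log_mul h₁ h₂]
    ring
  have hsum : ∑ i, p i * Real.log (q i) = -(∑ b, ∑ w, (G₁ b w).negMulLog)
      - (∑ w, ∑ c, (G₂ w c).negMulLog) + ∑ w, (G w).negMulLog := by
    simp only [Fintype.sum_prod_type, p, q, hlog, Finset.sum_add_distrib, Finset.sum_sub_distrib,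
      Real.negMulLog, neg_mul, Finset.sum_neg_distrib, neg_neg, sub_neg_eq_add]
    rw [← sub_eq_add_neg]
    congr 1
    · congr 1
      · simp only [← Finset.sum_mul, hG₁]
      · rw [Finset.sum_comm]
        refine Finset.sum_congr rfl fun w _ => ?_
        rw [Finset.sum_comm]
        simp only [← Finset.sum_mul, hG₂]
    · rw [Finset.sum_comm]
      simp only [← Finset.sum_mul, hG]
  have hself : ∑ i, p i * Real.log (p i) = -∑ b, ∑ w, ∑ c, (F b w c).negMulLog := by
    simp only [Fintype.sum_prod_type, p, Real.negMulLog, neg_mul, Finset.sum_neg_distrib, neg_neg]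
  refine ⟨?_, fun h b w c => gibbs_eq hp hq hpq hs ?_ (b, w, c)⟩
  · have := gibbs_le hp hq hpq hs
    linarith
  · linarith

lemma snoc_const_eq_cons_const {A : Type*} (a b : A) :
    (Fin.snoc (fun _ : Fin 1 => a) b : Fin 2 → A) = Fin.cons a fun _ => b := by
  funext i
  refine Fin.cases rfl (fun j => ?_) i
  obtain rfl := Subsingleton.elim j 0
  rfl

variable {A : Type*} [Fintype A]

lemma sum_fin_cons {n : ℕ} (f : (Fin (n + 1) → A) → ℝ) :
    ∑ w, f w = ∑ b, ∑ w : Fin n → A, f (Fin.cons b w) := by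
  rw [← Fintype.sum_prod_type']
  exact (Fintype.sum_equiv (Fin.consEquiv fun _ => A) _ _ fun _ => rfl).symm

lemma sum_fin_snoc {n : ℕ} (f : (Fin (n + 1) → A) → ℝ) :
    ∑ w, f w = ∑ w : Fin n → A, ∑ a, f (Fin.snoc w a) := by
  rw [← Fintype.sum_prod_type_right']
  exact (Fintype.sum_equiv (Fin.snocEquiv fun _ => A) _ _ fun _ => rfl).symm

/-- Word weights that are consistent under adding a letter on either side. -/
structure IsStationaryFamily (F : ∀ n, (Fin n → A) → ℝ) : Prop where
  nonneg : ∀ n w, 0 ≤ F n w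
  sum_cons : ∀ n w, ∑ b, F (n + 1) (Fin.cons b w) = F n w
  sum_snoc : ∀ n w, ∑ a, F (n + 1) (Fin.snoc w a) = F n w

/-- Shannon entropy of the words of length `n`. -/
noncomputable def wordEnt (F : ∀ n, (Fin n → A) → ℝ) (n : ℕ) : ℝ := ∑ w, (F n w).negMulLog

namespace IsStationaryFamily

variable {F : ∀ n, (Fin n → A) → ℝ}

lemma wordEnt_concave (hF : IsStationaryFamily F) (n : ℕ) :
    wordEnt F (n + 2) + wordEnt F n ≤ wordEnt F (n + 1) + wordEnt F (n + 1) ∧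
    (wordEnt F (n + 1) + wordEnt F (n + 1) ≤ wordEnt F (n + 2) + wordEnt F n →
      ∀ b w a, F (n + 2) (Fin.cons b (Fin.snoc w a)) =
        F (n + 1) (Fin.cons b w) * F (n + 1) (Fin.snoc w a) / F n w) := by
  have h := negMulLog_ssa (F := fun b (w : Fin n → A) a => F (n + 2) (Fin.cons b (Fin.snoc w a)))
    fun _ _ _ => hF.nonneg _ _
  have h₁ : ∀ b (w : Fin n → A), ∑ a, F (n + 2) (Fin.cons b (Fin.snoc w a)) =
      F (n + 1) (Fin.cons b w) := fun b w => by
    rw [← hF.sum_snoc (n + 1) (Fin.cons b w)]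
    simp only [Fin.cons_snoc_eq_snoc_cons]
  simp only [h₁, hF.sum_cons] at h
  have e₁ : wordEnt F (n + 2) =
      ∑ b, ∑ w : Fin n → A, ∑ a, (F (n + 2) (Fin.cons b (Fin.snoc w a))).negMulLog := by
    rw [wordEnt, sum_fin_cons]
    simp only [sum_fin_snoc]
  have e₂ : wordEnt F (n + 1) =
      ∑ b, ∑ w : Fin n → A, (F (n + 1) (Fin.cons b w)).negMulLog := sum_fin_cons _
  have e₃ : wordEnt F (n + 1) =
      ∑ w : Fin n → A, ∑ a, (F (n + 1) (Fin.snoc w a)).negMulLog := sum_fin_snoc _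
  rw [← e₁, ← e₂, ← e₃] at h
  exact h

lemma antitone_wordEnt_sub (hF : IsStationaryFamily F) :
    Antitone fun n => wordEnt F (n + 1) - wordEnt F n :=
  antitone_nat_of_succ_le fun n => by linarith [(hF.wordEnt_concave n).1]

lemma le_wordEnt_sub (hF : IsStationaryFamily F) {h : ℝ} (hh : ∀ n, n * h ≤ wordEnt F n) (n : ℕ) :
    h ≤ wordEnt F (n + 1) - wordEnt F n := by
  by_contra! hlt
  set d := wordEnt F (n + 1) - wordEnt F n with hd
  have hup : ∀ m : ℕ, wordEnt F (n + m) ≤ wordEnt F n + m * d := fun m => by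
    induction m with
    | zero => simp
    | succ m ih =>
      have : wordEnt F (n + m + 1) - wordEnt F (n + m) ≤ d :=
        hF.antitone_wordEnt_sub (Nat.le_add_right n m)
      push_cast
      rw [← add_assoc]
      linarith
  obtain ⟨m, hm⟩ := exists_nat_gt ((wordEnt F n - n * h) / (h - d))
  rw [div_lt_iff₀ (by linarith)] at hm
  have h1 := hup m
  have h2 := hh (n + m)
  push_cast at h2
  linarith

/-- The weights of words of length two, as a function of two letters. -/
def pair (F : ∀ n, (Fin n → A) → ℝ) (a b : A) : ℝ := F 2 (Fin.snoc (fun _ : Fin 1 => a) b)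

lemma sum_pair (hF : IsStationaryFamily F) (a : A) : ∑ b, pair F a b = F 1 fun _ => a :=
  hF.sum_snoc 1 _

lemma sum_pair_left (hF : IsStationaryFamily F) (a : A) : ∑ b, pair F b a = F 1 fun _ => a := by
  simp only [pair, snoc_const_eq_cons_const]
  exact hF.sum_cons 1 _

lemma sum_fin_one (f : (Fin 1 → A) → ℝ) : ∑ w, f w = ∑ a, f fun _ => a :=
  Fintype.sum_equiv (Equiv.funUnique (Fin 1) A) _ _ fun w =>
    congrArg f (funext fun _ => congrArg w (Subsingleton.elim _ _))

lemma sum_sum_pair (hF : IsStationaryFamily F) : ∑ a, ∑ b, pair F a b = F 0 Fin.elim0 := by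
  simp only [hF.sum_pair]
  rw [← hF.sum_cons 0]
  refine Finset.sum_congr rfl fun a _ => congrArg (F 1) (funext fun i => ?_)
  obtain rfl := Subsingleton.elim i 0
  rfl

lemma condEnt_pair (hF : IsStationaryFamily F) :
    condEnt (pair F) = wordEnt F 2 - wordEnt F 1 := by
  have e : wordEnt F 2 = ∑ a, ∑ b, (pair F a b).negMulLog := by
    rw [wordEnt, sum_fin_snoc, sum_fin_one]
    rfl
  rw [e, wordEnt, sum_fin_one, ← Finset.sum_sub_distrib, condEnt]
  refine Finset.sum_congr rfl fun a _ => ?_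
  rw [← hF.sum_pair a]
  simp only [mul_sub, Finset.sum_sub_distrib, ← Finset.sum_mul, Real.negMulLog, neg_mul,
    Finset.sum_neg_distrib]
  ring

/-- A family of maximal entropy is determined by its words of length two. -/
lemma ext_of_pair {F' : ∀ n, (Fin n → A) → ℝ} (hF : IsStationaryFamily F)
    (hF' : IsStationaryFamily F') (hd : ∀ n, wordEnt F (n + 2) - wordEnt F (n + 1) =
      wordEnt F 2 - wordEnt F 1) (hd' : ∀ n, wordEnt F' (n + 2) - wordEnt F' (n + 1) =
      wordEnt F' 2 - wordEnt F' 1) (hpair : pair F = pair F') (n : ℕ) : F (n + 1) = F' (n + 1) := by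
  induction n using Nat.strong_induction_on with
  | _ n ih =>
    match n with
    | 0 =>
      funext w
      have hw : w = fun _ => w 0 := funext fun i => congrArg w (Fin.fin_one_eq_zero i)
      rw [hw]
      exact (hF.sum_pair (w 0)).symm.trans (hpair ▸ hF'.sum_pair (w 0))
    | 1 =>
      funext w
      rw [← Fin.snoc_init_self w]
      have : Fin.init w = fun _ : Fin 1 => w 0 := funext fun i => by
        obtain rfl := Subsingleton.elim i 0
        rfl
      rw [this]
      exact congrFun (congrFun hpair _) _
    | n + 2 =>
      funext w
      rw [← Fin.cons_self_tail w, ← Fin.snoc_init_self (Fin.tail w),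
        (hF.wordEnt_concave (n + 1)).2 (by linarith [hd n, hd (n + 1)]),
        (hF'.wordEnt_concave (n + 1)).2 (by linarith [hd' n, hd' (n + 1)]),
        ih (n + 1) (by omega), ih n (by omega)]

end IsStationaryFamily

open IsStationaryFamily in
lemma eq_or_two_mul_exp_entropy_le_of_family {A : Type} [Fintype A] (X : NNSFT 1 A)
    {F F' : ∀ n, (Fin n → A) → ℝ} (hF : IsStationaryFamily F) (hF' : IsStationaryFamily F')
    (hF0 : F 0 Fin.elim0 = 1) (hF0' : F' 0 Fin.elim0 = 1)
    (hX : ∀ a b, pair F a b ≠ 0 → X.adj 0 a b) (hX' : ∀ a b, pair F' a b ≠ 0 → X.adj 0 a b)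
    (hent : ∀ n, n * X.entropy ≤ wordEnt F n) (hent' : ∀ n, n * X.entropy ≤ wordEnt F' n) :
    (∀ n, F (n + 1) = F' (n + 1)) ∨ 2 * Real.exp X.entropy ≤ Fintype.card A := by
  have key : ∀ {F : ∀ n, (Fin n → A) → ℝ} (hF : IsStationaryFamily F)
      (_ : F 0 Fin.elim0 = 1) (_ : ∀ a b, pair F a b ≠ 0 → X.adj 0 a b)
      (_ : ∀ n, n * X.entropy ≤ wordEnt F n),
      (∑ a, ∑ b, pair F a b) * X.entropy ≤ condEnt (pair F) ∧
      ∀ n, wordEnt F (n + 2) - wordEnt F (n + 1) = wordEnt F 2 - wordEnt F 1 := by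
    intro F hF h0 hX hent
    have h1 : condEnt (pair F) ≤ (∑ a, ∑ b, pair F a b) * X.entropy :=
      condEnt_le_entropy X (fun a b => hF.nonneg _ _)
        (fun a => (hF.sum_pair a).trans (hF.sum_pair_left a).symm) hX
    have h2 := hF.le_wordEnt_sub hent
    rw [hF.sum_sum_pair, h0, one_mul] at h1 ⊢
    rw [hF.condEnt_pair] at h1 ⊢
    exact ⟨h2 1, fun n => le_antisymm (hF.antitone_wordEnt_sub (Nat.le_add_left 1 n))
      (h1.trans (h2 (n + 1)))⟩
  obtain ⟨hc, hd⟩ := key hF hF0 hX hent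
  obtain ⟨hc', hd'⟩ := key hF' hF0' hX' hent'
  refine (eq_or_two_mul_exp_entropy_le X (fun a b => hF.nonneg _ _) (fun a b => hF'.nonneg _ _)
    (fun a => (hF.sum_pair a).trans (hF.sum_pair_left a).symm)
    (fun a => (hF'.sum_pair a).trans (hF'.sum_pair_left a).symm) hX hX' ?_ hc hc').imp_left
    fun h => hF.ext_of_pair hF' hd hd' h
  exact (hF.sum_sum_pair.trans hF0).trans (hF'.sum_sum_pair.trans hF0').symm

end WordEntropy

section Measures

variable {A : Type}

/-- The probability of seeing the word `w` at the sites `1, …, n`. -/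
noncomputable def wordProb (μ : Measure (Site 1 → A)) (n : ℕ) (w : Fin n → A) : ℝ :=
  μ.real {x | ∀ i : Fin n, x (fun _ => (i : ℤ) + 1) = w i}

lemma measurableSet_letter (v : Site 1) (S : Set A) :
    MeasurableSet {x : Site 1 → A | x v ∈ S} := by
  let _ : MeasurableSpace A := ⊤
  exact (measurable_pi_apply v : Measurable fun x : Site 1 → A => x v) trivial

lemma measurableSet_pts [Finite A] (X : NNSFT 1 A) : MeasurableSet X.pts := by
  have : X.pts = ⋂ i : Fin 1, ⋂ v : Site 1, ⋃ a : A, ⋃ b : A, ⋃ _ : X.adj i a b,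
      {x : Site 1 → A | x v ∈ ({a} : Set A)} ∩
        {x : Site 1 → A | x (v + unitVec 1 i) ∈ ({b} : Set A)} := by
    ext x
    simp [NNSFT.pts]
  rw [this]
  exact .iInter fun i => .iInter fun v => .iUnion fun a => .iUnion fun b => .iUnion fun _ =>
    (measurableSet_letter _ _).inter (measurableSet_letter _ _)

lemma measurableSet_word (n : ℕ) (f : Fin n → Site 1) (w : Fin n → A) :
    MeasurableSet {x : Site 1 → A | ∀ i, x (f i) = w i} := by
  have : {x : Site 1 → A | ∀ i, x (f i) = w i} =
      ⋂ i, {x : Site 1 → A | x (f i) ∈ ({w i} : Set A)} := by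
    ext x
    simp
  rw [this]
  exact .iInter fun i => measurableSet_letter _ _

lemma measurable_shiftMap (t : Site 1) : Measurable (shiftMap (A := A) t) := by
  let _ : MeasurableSpace A := ⊤
  exact measurable_pi_lambda _ fun v => measurable_pi_apply (v + t)

/-- The probability of a word does not depend on its position. -/
lemma real_word_shift {μ : Measure (Site 1 → A)} (hμ : shiftInv μ) {n : ℕ} (t : ℤ)
    (w : Fin n → A) :
    μ.real {x | ∀ i : Fin n, x (fun _ => (i : ℤ) + 1 + t) = w i} = wordProb μ n w := by
  conv_rhs => rw [wordProb, ← hμ fun _ => t]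
  rw [map_measureReal_apply (measurable_shiftMap _) (measurableSet_word n _ w)]
  rfl

lemma real_eq_sum_real_letter [Fintype A] (μ : Measure (Site 1 → A)) [IsFiniteMeasure μ]
    (s : Set (Site 1 → A)) (v : Site 1) : μ.real s = ∑ a, μ.real (s ∩ {x | x v = a}) := by
  classical
  have h := measureReal_biUnion_finset (μ := μ.restrict s) (s := (Finset.univ : Finset A))
    (f := fun a => {x : Site 1 → A | x v = a})
    (fun a _ b _ hab => Set.disjoint_left.2 fun x ha hb => hab (ha.symm.trans hb))
    (fun a _ => measurableSet_letter v {a})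
  have hU : ⋃ a ∈ (Finset.univ : Finset A), {x : Site 1 → A | x v = a} = Set.univ := by
    ext x
    simp
  rw [hU, measureReal_restrict_apply .univ, Set.univ_inter] at h
  rw [h]
  refine Finset.sum_congr rfl fun a _ => ?_
  rw [measureReal_restrict_apply (show MeasurableSet {x : Site 1 → A | x v = a} from
    measurableSet_letter v {a}), Set.inter_comm]

lemma isStationaryFamily_wordProb [Fintype A] (μ : Measure (Site 1 → A)) [IsFiniteMeasure μ]
    (hμ : shiftInv μ) : IsStationaryFamily (wordProb μ) where
  nonneg _ _ := measureReal_nonneg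
  sum_cons n w := by
    rw [← real_word_shift hμ 1 w, real_eq_sum_real_letter μ _ fun _ => 1]
    refine Finset.sum_congr rfl fun a _ => congrArg μ.real (Set.ext fun x => ?_)
    simp [Fin.forall_fin_succ, and_comm]
  sum_snoc n w := by
    rw [wordProb, real_eq_sum_real_letter μ _ fun _ => (n : ℤ) + 1]
    refine Finset.sum_congr rfl fun a _ => congrArg μ.real (Set.ext fun x => ?_)
    simp [Fin.forall_fin_succ']

lemma blockEnt_eq_wordEnt [Fintype A] (μ : Measure (Site 1 → A)) (n : ℕ) :
    blockEnt μ n = wordEnt (wordProb μ) n := by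
  refine (Fintype.sum_equiv ((Equiv.funUnique (Fin 1) (Fin n)).arrowCongr (Equiv.refl A)) _ _
    fun w => congrArg (fun s => Real.negMulLog (μ.real s)) (Set.ext fun x => ?_))
  refine ⟨fun h i => ?_, fun h p => ?_⟩
  · exact h fun _ => i
  · have hp : p = fun _ => p 0 := funext fun j => congrArg p (Subsingleton.elim _ _)
    rw [hp]
    exact h (p 0)

lemma wordEnt_wordProb_nonneg [Fintype A] (μ : Measure (Site 1 → A)) [IsProbabilityMeasure μ]
    (n : ℕ) : 0 ≤ wordEnt (wordProb μ) n :=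
  Finset.sum_nonneg fun _ _ => Real.negMulLog_nonneg measureReal_nonneg measureReal_le_one

lemma mul_entropy_le_wordEnt [Fintype A] {X : NNSFT 1 A} {μ : Measure (Site 1 → A)}
    (hμ : X.isMME μ) (n : ℕ) : n * X.entropy ≤ wordEnt (wordProb μ) n := by
  obtain ⟨hprob, -, -, hent⟩ := hμ
  rcases n.eq_zero_or_pos with rfl | hn
  · simpa using wordEnt_wordProb_nonneg μ 0
  have hbdd : BddBelow (Set.range fun n : ℕ+ => blockEnt μ (n : ℕ) / ((n : ℕ) : ℝ) ^ 1) := by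
    refine ⟨0, ?_⟩
    rintro _ ⟨m, rfl⟩
    have := wordEnt_wordProb_nonneg μ m
    rw [← blockEnt_eq_wordEnt] at this
    positivity
  have h : measEnt μ ≤ blockEnt μ n / (n : ℝ) ^ 1 := ciInf_le hbdd ⟨n, hn⟩
  rw [hent, pow_one, blockEnt_eq_wordEnt, le_div_iff₀' (by exact_mod_cast hn)] at h
  exact h

lemma adj_of_pair_ne_zero [Fintype A] {X : NNSFT 1 A} {μ : Measure (Site 1 → A)}
    (hμ : X.isMME μ) (a b : A) (hab : IsStationaryFamily.pair (wordProb μ) a b ≠ 0) :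
    X.adj 0 a b := by
  obtain ⟨hprob, -, hX, -⟩ := hμ
  by_contra hadj
  refine hab ((measureReal_eq_zero_iff).2 (measure_mono_null (t := X.ptsᶜ) (fun x hx hxX => ?_)
    ((prob_compl_eq_zero_iff (measurableSet_pts X)).2 hX)))
  have h0 : x (fun _ => 1) = a := by simpa using hx 0
  have h1 : x (fun _ => 2) = b := by simpa [Fin.snoc] using hx 1
  have h := hxX 0 fun _ => 1
  have hv : ((fun _ => 1) + unitVec 1 0 : Site 1) = fun _ => 2 := funext fun j => by
    obtain rfl := Subsingleton.elim j 0
    simp [unitVec]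
  rw [hv, h0, h1] at h
  exact hadj h

/-- Shift invariant measures with the same word probabilities are equal. -/
lemma measure_ext_of_wordProb [Fintype A] {μ ν : Measure (Site 1 → A)} [IsProbabilityMeasure μ]
    [IsProbabilityMeasure ν] (hμ : shiftInv μ) (hν : shiftInv ν)
    (h : ∀ n, wordProb μ (n + 1) = wordProb ν (n + 1)) : μ = ν := by
  let _ : MeasurableSpace A := ⊤
  have hwin : ∀ (n : ℕ) (t : ℤ), μ.map (fun x (i : Fin (n + 1)) => x fun _ => (i : ℤ) + 1 + t) =
      ν.map fun x (i : Fin (n + 1)) => x fun _ => (i : ℤ) + 1 + t := fun n t => by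
    have hm : Measurable fun (x : Site 1 → A) (i : Fin (n + 1)) => x fun _ => (i : ℤ) + 1 + t :=
      measurable_pi_lambda _ fun i => measurable_pi_apply _
    refine Measure.ext_of_singleton fun w => ?_
    have hs : (fun (x : Site 1 → A) (i : Fin (n + 1)) => x fun _ => (i : ℤ) + 1 + t) ⁻¹' {w} =
        {x | ∀ i : Fin (n + 1), x (fun _ => (i : ℤ) + 1 + t) = w i} :=
      Set.ext fun x => funext_iff
    rw [Measure.map_apply hm (measurableSet_singleton w),
      Measure.map_apply hm (measurableSet_singleton w), hs,
      ← measureReal_eq_measureReal_iff, real_word_shift hμ, real_word_shift hν, h]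
  refine IsProjectiveLimit.unique (P := fun I => ν.map I.restrict) (fun I => ?_) fun I => rfl
  obtain ⟨m, hm⟩ : ∃ m : ℕ, ∀ v ∈ I, (v 0).natAbs ≤ m :=
    ⟨I.sup fun v => (v 0).natAbs, fun v hv => Finset.le_sup (f := fun v => (v 0).natAbs) hv⟩
  let ψ : (Fin (2 * m + 1) → A) → I → A := fun w v =>
    w ⟨(v.1 0 + m).toNat, by have := hm v.1 v.2; omega⟩
  have hψ : Measurable ψ := measurable_pi_lambda _ fun v => measurable_pi_apply _
  have hφ : Measurable fun (x : Site 1 → A) (i : Fin (2 * m + 1)) =>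
      x fun _ => (i : ℤ) + 1 + (-m - 1) :=
    measurable_pi_lambda _ fun i => measurable_pi_apply _
  have hcomp : (I.restrict : (Site 1 → A) → I → A) =
      ψ ∘ fun x i => x fun _ => (i : ℤ) + 1 + (-m - 1) := by
    funext x v
    refine congrArg x (funext fun j => ?_)
    obtain rfl := Subsingleton.elim j 0
    have := hm v.1 v.2
    simp only
    omega
  dsimp only
  rw [hcomp, ← Measure.map_map hψ hφ, ← Measure.map_map hψ hφ, hwin]

end Measures

theorem two_mme_alphabet_bound {A : Type} [Fintype A] (X : NNSFT 1 A)
    (μ ν : Measure (Site 1 → A)) (hμ : X.isMME μ) (hν : X.isMME ν)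
    (hne : μ ≠ ν) :
    (Fintype.card A : ℝ) ≥ 2 * Real.exp X.entropy ∧
    Real.log (Fintype.card A) - X.entropy ≥ Real.log 2 := by
  have : IsProbabilityMeasure μ := hμ.1
  have : IsProbabilityMeasure ν := hν.1
  have hempty : ∀ (ρ : Measure (Site 1 → A)) [IsProbabilityMeasure ρ],
      wordProb ρ 0 Fin.elim0 = 1 := fun ρ _ => by simp [wordProb]
  have hcard : 2 * Real.exp X.entropy ≤ Fintype.card A :=
    (eq_or_two_mul_exp_entropy_le_of_family X (isStationaryFamily_wordProb μ hμ.2.1)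
      (isStationaryFamily_wordProb ν hν.2.1) (hempty μ) (hempty ν) (adj_of_pair_ne_zero hμ)
      (adj_of_pair_ne_zero hν) (mul_entropy_le_wordEnt hμ)
      (mul_entropy_le_wordEnt hν)).resolve_left
      fun h => hne (measure_ext_of_wordProb hμ.2.1 hν.2.1 h)
  refine ⟨hcard, ?_⟩
  have h := Real.log_le_log (by positivity) hcard
  rw [Real.log_mul two_ne_zero (Real.exp_ne_zero _), Real.log_exp] at h
  linarith
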